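/- For every oracle A ⊆ ℕ the following are equivalent: (i) A is high; (ii) there is a Kurtz test (G_m) relative to A such that for every Kurtz test (L_m) and all but finitely many m, L_{2m} ∪ L_{2m+1} ⊆ G_m; (iii) there is a Kurtz test (G_m) relative to A such that for every Kurtz test (L_m) there is m₀ with ⋂_{m≥m₀} L_m ⊆ ⋂_{m≥m₀} G_m; (iv) A is Kurtz engulfing. -/

import Mathlib

open Filter

namespace CichonAnalog

/-! ### Oracle computability -/

/-- Partial functions `ℕ →. ℕ` partial recursive relative to the oracle `A ⊆ ℕ`.
This is Mathlib's `Nat.Partrec` with an extra base case for the characteristic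
function of the oracle. -/
inductive RecursiveIn (A : Set ℕ) : (ℕ →. ℕ) → Prop
  | zero : RecursiveIn A (pure 0)
  | succ : RecursiveIn A ↑Nat.succ
  | left : RecursiveIn A ↑fun n : ℕ => n.unpair.1
  | right : RecursiveIn A ↑fun n : ℕ => n.unpair.2
  | oracle : RecursiveIn A ↑fun n : ℕ => A.indicator (fun _ => 1) n
  | pair {f g} : RecursiveIn A f → RecursiveIn A g →
      RecursiveIn A fun n => Nat.pair <$> f n <*> g n
  | comp {f g} : RecursiveIn A f → RecursiveIn A g →
      RecursiveIn A fun n => g n >>= f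
  | prec {f g} : RecursiveIn A f → RecursiveIn A g →
      RecursiveIn A (Nat.unpaired fun a n =>
        n.rec (f a) fun y IH => do let i ← IH; g (Nat.pair a (Nat.pair y i)))
  | rfind {f} : RecursiveIn A f →
      RecursiveIn A fun a => Nat.rfind fun n => (fun m => m = 0) <$> f (Nat.pair a n)

/-- The partial function `f` (between coded spaces) is partial recursive in the oracle `A`. -/
def PartrecIn (A : Set ℕ) {α σ : Type} [Primcodable α] [Primcodable σ] (f : α →. σ) : Prop :=
  RecursiveIn A fun n =>
    Part.bind ↑(Encodable.decode (α := α) n) fun a => (f a).map Encodable.encode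

/-- `f ≤_T A` : the (total) function `f` is computable from the oracle `A`. -/
def ComputableIn (A : Set ℕ) {α σ : Type} [Primcodable α] [Primcodable σ] (f : α → σ) : Prop :=
  PartrecIn A (f : α →. σ)

/-- `W` is computably enumerable in the oracle `A`. -/
def CEIn (A : Set ℕ) {α : Type} [Primcodable α] (W : Set α) : Prop :=
  ∃ f : α →. ℕ, PartrecIn A f ∧ ∀ a, a ∈ W ↔ (f a).Dom

/-- `W` is computably enumerable (unrelativized). -/
def CE {α : Type} [Primcodable α] (W : Set α) : Prop :=
  ∃ f : α →. ℕ, Partrec f ∧ ∀ a, a ∈ W ↔ (f a).Dom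

/-! ### Cantor space, `Π⁰₁` classes, effective meagerness -/

/-- The basic clopen set (cylinder) of the finite binary string `σ` in Cantor space. -/
def Cyl (σ : List Bool) : Set (ℕ → Bool) :=
  {x | ∀ i, i < σ.length → x i = σ.getD i false}

/-- `P` is a `Π⁰₁(A)` class: a closed subset of Cantor space whose complement is the
union of basic clopen sets over a set of strings c.e. in `A`. -/
def Pi01In (A : Set ℕ) (P : Set (ℕ → Bool)) : Prop :=
  ∃ W : Set (List Bool), CEIn A W ∧ P = (⋃ σ ∈ W, Cyl σ)ᶜ

/-- `P` is a (plain) `Π⁰₁` class. -/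
def Pi01 (P : Set (ℕ → Bool)) : Prop :=
  ∃ W : Set (List Bool), CE W ∧ P = (⋃ σ ∈ W, Cyl σ)ᶜ

/-- `C` is a uniformly `Π⁰₁(A)` sequence of classes. -/
def UnifPi01In (A : Set ℕ) (C : ℕ → Set (ℕ → Bool)) : Prop :=
  ∃ W : Set (ℕ × List Bool), CEIn A W ∧
    ∀ m, C m = (⋃ σ ∈ {s | (m, s) ∈ W}, Cyl σ)ᶜ

/-- `C` is a uniformly `Π⁰₁` sequence of classes. -/
def UnifPi01 (C : ℕ → Set (ℕ → Bool)) : Prop :=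
  ∃ W : Set (ℕ × List Bool), CE W ∧
    ∀ m, C m = (⋃ σ ∈ {s | (m, s) ∈ W}, Cyl σ)ᶜ

/-- `S` is effectively meager relative to `A`: it is contained in the union of a
uniformly `Π⁰₁(A)` sequence of nowhere dense classes. -/
def EffMeagerIn (A : Set ℕ) (S : Set (ℕ → Bool)) : Prop :=
  ∃ C : ℕ → Set (ℕ → Bool), UnifPi01In A C ∧ (∀ m, IsNowhereDense (C m)) ∧ S ⊆ ⋃ m, C m

/-- `S` is effectively meager (unrelativized). -/
def EffMeager (S : Set (ℕ → Bool)) : Prop :=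
  ∃ C : ℕ → Set (ℕ → Bool), UnifPi01 C ∧ (∀ m, IsNowhereDense (C m)) ∧ S ⊆ ⋃ m, C m

/-- `A` is meager engulfing: some `A`-effectively meager set contains every
effectively meager set. -/
def MeagerEngulfing (A : Set ℕ) : Prop :=
  ∃ S, EffMeagerIn A S ∧ ∀ T, EffMeager T → T ⊆ S

/-- `A` is weakly meager engulfing: some `A`-effectively meager set contains every
computable element of Cantor space. -/
def WeaklyMeagerEngulfing (A : Set ℕ) : Prop :=
  ∃ S, EffMeagerIn A S ∧ ∀ x : ℕ → Bool, Computable x → x ∈ S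

/-- `V` is a computable set of finite binary strings. -/
def ComputableStringSet (V : Set (List Bool)) : Prop :=
  ∃ χ : List Bool → Bool, Computable χ ∧ ∀ s, s ∈ V ↔ χ s = true

/-- `V` is a dense set of finite binary strings: every string has an extension in `V`. -/
def DenseStringSet (V : Set (List Bool)) : Prop :=
  ∀ σ : List Bool, ∃ τ ∈ V, σ <+: τ

/-- `x ∈ 2^ω` is weakly 1-generic: for every computable dense set `V` of finite
binary strings, some initial segment of `x` lies in `V`. -/
def Weakly1Generic (x : ℕ → Bool) : Prop :=
  ∀ V : Set (List Bool), ComputableStringSet V → DenseStringSet V →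
    ∃ n, (List.ofFn fun i : Fin n => x i) ∈ V

/-! ### Domination properties -/

/-- `A` is high: `A` computes a function dominating every total computable function. -/
def High (A : Set ℕ) : Prop :=
  ∃ f : ℕ → ℕ, ComputableIn A f ∧
    ∀ g : ℕ → ℕ, Computable g → ∀ᶠ n in atTop, g n ≤ f n

/-- `A` is of hyperimmune degree: `A` computes a function not dominated by any
computable function. -/
def HyperimmuneDegree (A : Set ℕ) : Prop :=
  ∃ f : ℕ → ℕ, ComputableIn A f ∧
    ∀ g : ℕ → ℕ, Computable g → ∃ᶠ n in atTop, g n < f n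

/-- `A` is of hyperimmune-free degree: every function computable in `A` is dominated
by a total computable function. -/
def HyperimmuneFree (A : Set ℕ) : Prop :=
  ∀ f : ℕ → ℕ, ComputableIn A f →
    ∃ g : ℕ → ℕ, Computable g ∧ ∀ᶠ n in atTop, f n ≤ g n

/-! ### Measure on Cantor space, Kurtz and Schnorr tests -/

open scoped Classical in
/-- The uniform measure of the clopen set `⋃ σ ∈ F, [σ]` determined by the finite
list `F` of binary strings: count the binary strings of maximal length extending
some member of `F`, and normalize. -/
noncomputable def listMeasure (F : List (List Bool)) : ℚ :=
  letI k := (F.map List.length).foldr max 0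
  ((Finset.univ.filter fun v : Fin k → Bool =>
      ∃ σ ∈ F, σ <+: List.ofFn v).card : ℚ) / 2 ^ k

/-- The clopen subset of Cantor space given explicitly as a finite union of
basic clopen sets. -/
def ClopSet (F : List (List Bool)) : Set (ℕ → Bool) := ⋃ σ ∈ F, Cyl σ

/-- The effectively open subset of Cantor space enumerated by the sequence of
finite stages `g`. -/
def OpenSet (g : ℕ → List (List Bool)) : Set (ℕ → Bool) := ⋃ s, ClopSet (g s)

/-- The measure of the open set enumerated by the stages `g`: the supremum of the
measures of its finite partial unions. -/
noncomputable def openMeasure (g : ℕ → List (List Bool)) : ℝ :=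
  ⨆ s : ℕ, (listMeasure ((List.range (s + 1)).flatMap g) : ℝ)

/-- A Kurtz test relative to `A`: an `A`-computable sequence of explicitly given
clopen sets, the `m`-th of measure at most `2 ^ (-m)`. -/
def KurtzTestIn (A : Set ℕ) (G : ℕ → List (List Bool)) : Prop :=
  ComputableIn A G ∧ ∀ m, listMeasure (G m) ≤ (1 / 2) ^ m

/-- A (plain) Kurtz test. -/
def KurtzTest (G : ℕ → List (List Bool)) : Prop :=
  Computable G ∧ ∀ m, listMeasure (G m) ≤ (1 / 2) ^ m

/-- A Schnorr test relative to `A`: an `A`-computable doubly indexed sequence of finite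
stages such that the `m`-th effectively open set `⋃ s, ClopSet (g m s)` has measure at
most `2 ^ (-m)`, and this measure is a real computable in `A` uniformly in `m`. -/
def SchnorrTestIn (A : Set ℕ) (g : ℕ → ℕ → List (List Bool)) : Prop :=
  ComputableIn A (fun p : ℕ × ℕ => g p.1 p.2) ∧
  (∀ m, openMeasure (g m) ≤ (1 / 2) ^ m) ∧
  ∃ q : ℕ × ℕ → ℚ, ComputableIn A q ∧
    ∀ m k, |openMeasure (g m) - (q (m, k) : ℝ)| ≤ (1 / 2) ^ k

/-- A (plain) Schnorr test. -/
def SchnorrTest (g : ℕ → ℕ → List (List Bool)) : Prop :=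
  Computable (fun p : ℕ × ℕ => g p.1 p.2) ∧
  (∀ m, openMeasure (g m) ≤ (1 / 2) ^ m) ∧
  ∃ q : ℕ × ℕ → ℚ, Computable q ∧
    ∀ m k, |openMeasure (g m) - (q (m, k) : ℝ)| ≤ (1 / 2) ^ k

/-- `N` is Schnorr null relative to `A`. -/
def SchnorrNullIn (A : Set ℕ) (N : Set (ℕ → Bool)) : Prop :=
  ∃ g, SchnorrTestIn A g ∧ N ⊆ ⋂ m, OpenSet (g m)

/-- `N` is Schnorr null (unrelativized). -/
def SchnorrNull (N : Set (ℕ → Bool)) : Prop :=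
  ∃ g, SchnorrTest g ∧ N ⊆ ⋂ m, OpenSet (g m)

/-- `x ∈ 2^ω` is Schnorr random: it belongs to no Schnorr null set. -/
def SchnorrRandom (x : ℕ → Bool) : Prop := ∀ N, SchnorrNull N → x ∉ N

/-- `A` is Kurtz engulfing: there is an `A`-computable sequence of Kurtz tests relative
to `A` such that every Kurtz null set is contained in the null set of one of them. -/
def KurtzEngulfing (A : Set ℕ) : Prop :=
  ∃ G : ℕ → ℕ → List (List Bool),
    ComputableIn A (fun p : ℕ × ℕ => G p.1 p.2) ∧
    (∀ i m, listMeasure (G i m) ≤ (1 / 2) ^ m) ∧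
    ∀ L, KurtzTest L → ∃ i, (⋂ m, ClopSet (L m)) ⊆ ⋂ m, ClopSet (G i m)

/-- `A` is weakly Kurtz engulfing: there is an `A`-computable sequence of Kurtz tests
relative to `A` such that the union of their null sets contains every computable
element of Cantor space. -/
def WeaklyKurtzEngulfing (A : Set ℕ) : Prop :=
  ∃ G : ℕ → ℕ → List (List Bool),
    ComputableIn A (fun p : ℕ × ℕ => G p.1 p.2) ∧
    (∀ i m, listMeasure (G i m) ≤ (1 / 2) ^ m) ∧
    ∀ x : ℕ → Bool, Computable x → ∃ i, x ∈ ⋂ m, ClopSet (G i m)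

/-- `A` is weakly Schnorr engulfing: some set Schnorr null relative to `A` contains
every computable element of Cantor space. -/
def WeaklySchnorrEngulfing (A : Set ℕ) : Prop :=
  ∃ N, SchnorrNullIn A N ∧ ∀ x : ℕ → Bool, Computable x → x ∈ N

/-! ### DNR and PA degrees -/

/-- The `e`-th partial computable function. -/
noncomputable def phi (e : ℕ) : ℕ →. ℕ := (Denumerable.ofNat Nat.Partrec.Code e).eval

/-- `h` is diagonally nonrecursive. -/
def DNRFun (h : ℕ → ℕ) : Prop := ∀ e, ∀ y ∈ phi e e, h e ≠ y

/-- `A` is DNR: `A` computes a diagonally nonrecursive function. -/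
def DNRDegree (A : Set ℕ) : Prop := ∃ h : ℕ → ℕ, ComputableIn A h ∧ DNRFun h

/-- `A` is PA: `A` computes a `{0,1}`-valued diagonally nonrecursive function. -/
def PA (A : Set ℕ) : Prop :=
  ∃ h : ℕ → ℕ, ComputableIn A h ∧ (∀ e, h e ≤ 1) ∧ DNRFun h

/-! ### Traces -/

/-- The trace `σ` (satisfying `|σ n| ≤ n`) traces the function `f` if
`f n ∈ σ n` for all but finitely many `n`. -/
def Traces (σ : ℕ → Finset ℕ) (f : ℕ → ℕ) : Prop := ∀ᶠ n in atTop, f n ∈ σ n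

/-- `σ` is a `(D, g)`-trace relative to `A`: `D` is infinite and c.e. in `A`, `g` is a
partial `A`-computable function with `D ⊆ dom g` and `g n ≥ n` on its domain, and `σ`
is partial `A`-computable, defined on `D`, with `|σ n| < g n` for all `n ∈ D`. -/
def IsDGTraceIn (A : Set ℕ) (D : Set ℕ) (g : ℕ →. ℕ) (σ : ℕ →. Finset ℕ) : Prop :=
  D.Infinite ∧ CEIn A D ∧ PartrecIn A g ∧ D ⊆ g.Dom ∧ (∀ n, ∀ y ∈ g n, n ≤ y) ∧
  PartrecIn A σ ∧ D ⊆ σ.Dom ∧ ∀ n ∈ D, ∀ S ∈ σ n, ∀ b ∈ g n, S.card < b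

/-- `σ` is a `(D, g)`-trace (unrelativized). -/
def IsDGTrace (D : Set ℕ) (g : ℕ →. ℕ) (σ : ℕ →. Finset ℕ) : Prop :=
  D.Infinite ∧ CE D ∧ Partrec g ∧ D ⊆ g.Dom ∧ (∀ n, ∀ y ∈ g n, n ≤ y) ∧
  Partrec σ ∧ D ⊆ σ.Dom ∧ ∀ n ∈ D, ∀ S ∈ σ n, ∀ b ∈ g n, S.card < b

/-- The `(D, g)`-trace `σ` traces `f`: `f n ∈ σ n` for all but finitely many `n ∈ D`. -/
def DGTraces (D : Set ℕ) (σ : ℕ →. Finset ℕ) (f : ℕ → ℕ) : Prop :=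
  ∀ᶠ n in atTop, n ∈ D → ∀ S ∈ σ n, f n ∈ S

/-! ### Closure properties of oracle computability -/

section Oracle

variable {A : Set ℕ}

theorem RecursiveIn.of_eq {f g : ℕ →. ℕ} (hf : RecursiveIn A f) (h : ∀ n, g n = f n) :
    RecursiveIn A g :=
  (funext h : g = f) ▸ hf

theorem ComputableIn.of_eq {α σ : Type} [Primcodable α] [Primcodable σ] {f g : α → σ}
    (hf : ComputableIn A f) (h : ∀ a, g a = f a) : ComputableIn A g :=
  (funext h : g = f) ▸ hf

theorem RecursiveIn.of_natPartrec {f : ℕ →. ℕ} (hf : Nat.Partrec f) : RecursiveIn A f := by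
  induction hf with
  | zero => exact .zero
  | succ => exact .succ
  | left => exact .left
  | right => exact .right
  | pair _ _ ihf ihg => exact .pair ihf ihg
  | comp _ _ ihf ihg => exact .comp ihf ihg
  | prec _ _ ihf ihg => exact .prec ihf ihg
  | rfind _ ihf => exact .rfind ihf

theorem ComputableIn.of_computable {α σ : Type} [Primcodable α] [Primcodable σ] {f : α → σ}
    (hf : Computable f) : ComputableIn A f :=
  RecursiveIn.of_natPartrec hf

theorem ComputableIn.comp {α β σ : Type} [Primcodable α] [Primcodable β] [Primcodable σ]
    {g : β → σ} {f : α → β} (hg : ComputableIn A g) (hf : ComputableIn A f) :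
    ComputableIn A fun a => g (f a) := by
  refine RecursiveIn.of_eq (RecursiveIn.comp hg hf) fun n => ?_
  cases Encodable.decode (α := α) n <;> simp

theorem ComputableIn.pair {α β σ : Type} [Primcodable α] [Primcodable β] [Primcodable σ]
    {f : α → β} {g : α → σ} (hf : ComputableIn A f) (hg : ComputableIn A g) :
    ComputableIn A fun a => (f a, g a) := by
  refine RecursiveIn.of_eq (RecursiveIn.pair hf hg) fun n => ?_
  cases Encodable.decode (α := α) n <;> simp [Seq.seq]

theorem computableIn_nat_iff {f : ℕ → ℕ} : ComputableIn A f ↔ RecursiveIn A ↑f := by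
  unfold ComputableIn PartrecIn
  have : (fun n => Part.bind ↑(Encodable.decode (α := ℕ) n) fun a =>
      ((f : ℕ →. ℕ) a).map Encodable.encode) = (f : ℕ →. ℕ) := by
    funext n; simp
  rw [this]

theorem ComputableIn.nat_rec {f : ℕ → ℕ} {h : ℕ × ℕ × ℕ → ℕ} (hf : ComputableIn A f)
    (hh : ComputableIn A h) :
    ComputableIn A fun p : ℕ × ℕ =>
      Nat.rec (motive := fun _ => ℕ) (f p.1) (fun y i => h (p.1, y, i)) p.2 := by
  have hh' : ComputableIn A fun n : ℕ => h (n.unpair.1, n.unpair.2.unpair) :=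
    hh.comp (.of_computable <| (Computable.fst.comp .unpair).pair
      (Computable.unpair.comp (Computable.snd.comp .unpair)))
  have key := RecursiveIn.prec (computableIn_nat_iff.1 hf) (computableIn_nat_iff.1 hh')
  have key' : ComputableIn A fun n : ℕ => Nat.rec (motive := fun _ => ℕ) (f n.unpair.1)
      (fun y i => h (n.unpair.1, y, i)) n.unpair.2 := by
    rw [computableIn_nat_iff]
    refine RecursiveIn.of_eq key fun n => ?_
    simp only [Nat.unpaired, PFun.coe_val]
    induction n.unpair.2 with
    | zero => simp
    | succ k ih =>
      simp only [Part.bind_eq_bind, Nat.unpair_pair] at ih ⊢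
      rw [← ih, Part.bind_some]
  have := key'.comp (.of_computable (Primrec₂.natPair.to_comp : Computable₂ Nat.pair))
  simpa using this

theorem ComputableIn.sup_range {F : ℕ × ℕ → ℕ} (hF : ComputableIn A F) :
    ComputableIn A fun n => (Finset.range (n + 1)).sup fun i => F (i, n) := by
  have hmax : ComputableIn A fun p : ℕ × ℕ => max p.1 p.2 :=
    .of_computable Primrec.nat_max.to_comp
  have hq : Computable fun p : ℕ × ℕ × ℕ => (p.2.1, p.1) :=
    (Computable.fst.comp Computable.snd).pair Computable.fst
  have hF' : ComputableIn A fun p : ℕ × ℕ × ℕ => F (p.2.1, p.1) :=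
    hF.comp (.of_computable hq)
  have hp : ComputableIn A fun p : ℕ × ℕ × ℕ => (p.2.2, F (p.2.1, p.1)) :=
    ComputableIn.pair (f := fun p => p.2.2) (.of_computable (Computable.snd.comp .snd)) hF'
  have hh : ComputableIn A fun p : ℕ × ℕ × ℕ => max p.2.2 (F (p.2.1, p.1)) :=
    (hmax.comp hp).of_eq fun _ => rfl
  have hrec : ∀ n m, (Finset.range m).sup (fun i => F (i, n)) =
      Nat.rec (motive := fun _ => ℕ) 0 (fun y i => max i (F (y, n))) m := by
    intro n m
    induction m with
    | zero => rfl
    | succ k ih => rw [Finset.range_add_one, Finset.sup_insert, ih]; exact max_comm _ _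
  have hr : ComputableIn A fun p : ℕ × ℕ =>
      Nat.rec (motive := fun _ => ℕ) 0 (fun y i => max i (F (y, p.1))) p.2 :=
    ComputableIn.nat_rec (f := fun _ => 0) (h := fun q => max q.2.2 (F (q.2.1, q.1)))
      (.of_computable (Computable.const 0)) hh
  have hn : ComputableIn A fun n : ℕ => (n, n + 1) :=
    .of_computable (Computable.id.pair Computable.succ)
  exact (hr.comp hn).of_eq fun n => hrec n (n + 1)

end Oracle

/-! ### The measure of a clopen set -/

section Measure

open MeasureTheory

/-- The fair coin measure on Cantor space. -/
noncomputable def coinMeasure : Measure (ℕ → Bool) :=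
  Measure.infinitePi fun _ => (PMF.uniformOfFintype Bool).toMeasure

instance : IsProbabilityMeasure coinMeasure := by
  unfold coinMeasure; infer_instance

theorem coinMeasure_pi_singleton (s : Finset ℕ) (x : ℕ → Bool) :
    coinMeasure.real {y | ∀ i ∈ s, y i = x i} = (1 / 2) ^ s.card := by
  have h : {y : ℕ → Bool | ∀ i ∈ s, y i = x i} = Set.pi s fun i => {x i} := by
    ext y; simp [Set.mem_pi]
  rw [measureReal_def, h, coinMeasure,
    Measure.infinitePi_pi _ fun i _ => measurableSet_singleton (x i)]
  simp

theorem ClopSet_append (F F' : List (List Bool)) :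
    ClopSet (F ++ F') = ClopSet F ∪ ClopSet F' := by
  ext x; simp [ClopSet, or_and_right, exists_or]

theorem ClopSet_flatMap {α : Type} (l : List α) (f : α → List (List Bool)) :
    ClopSet (l.flatMap f) = ⋃ a ∈ l, ClopSet (f a) := by
  ext x
  simp only [ClopSet, List.mem_flatMap, Set.mem_iUnion]
  grind

/-- The maximal length of the strings in `F`. -/
def maxLength (F : List (List Bool)) : ℕ := (F.map List.length).foldr max 0

theorem length_le_maxLength {F : List (List Bool)} {σ : List Bool} (h : σ ∈ F) :
    σ.length ≤ maxLength F := by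
  induction F with
  | nil => simp at h
  | cons τ F ih =>
    simp only [maxLength, List.map_cons, List.foldr_cons]
    rcases List.mem_cons.1 h with rfl | h
    · exact le_max_left _ _
    · exact (ih h).trans (le_max_right _ _)

theorem mem_Cyl_iff_prefix_ofFn {σ : List Bool} {x : ℕ → Bool} {k : ℕ} (hk : σ.length ≤ k) :
    x ∈ Cyl σ ↔ σ <+: List.ofFn fun i : Fin k => x i := by
  rw [List.prefix_iff_getElem]
  simp only [Cyl, Set.mem_ofPred_eq, List.length_ofFn, List.getElem_ofFn]
  refine ⟨fun h => ⟨hk, fun i hi => ?_⟩, fun ⟨_, h⟩ i hi => ?_⟩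
  · rw [h i hi]; simp [hi]
  · rw [← h i hi]; simp [hi]

theorem mem_ClopSet_iff_prefix_ofFn {F : List (List Bool)} {x : ℕ → Bool} {k : ℕ}
    (hk : maxLength F ≤ k) :
    x ∈ ClopSet F ↔ ∃ σ ∈ F, σ <+: List.ofFn fun i : Fin k => x i := by
  simp only [ClopSet, Set.mem_iUnion, exists_prop]
  exact exists_congr fun σ => and_congr_right fun hσ =>
    mem_Cyl_iff_prefix_ofFn ((length_le_maxLength hσ).trans hk)

theorem mem_ClopSet_congr {F : List (List Bool)} {x y : ℕ → Bool}
    (h : ∀ i < maxLength F, x i = y i) : x ∈ ClopSet F ↔ y ∈ ClopSet F := by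
  rw [mem_ClopSet_iff_prefix_ofFn le_rfl, mem_ClopSet_iff_prefix_ofFn le_rfl]
  have : (fun i : Fin (maxLength F) => x i) = fun i : Fin (maxLength F) => y i :=
    funext fun i => h i i.2
  rw [this]

theorem listMeasure_eq (F : List (List Bool)) :
    (listMeasure F : ℝ) = coinMeasure.real (ClopSet F) := by
  classical
  set k := maxLength F with hk
  set S := Finset.univ.filter fun v : Fin k → Bool => ∃ σ ∈ F, σ <+: List.ofFn v with hS
  have hdef : listMeasure F = (S.card : ℚ) / 2 ^ k := by
    unfold listMeasure
    simp only [hS, hk, maxLength]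
    congr!
  let ext : (Fin k → Bool) → ℕ → Bool := fun v i => if h : i < k then v ⟨i, h⟩ else false
  let C : (Fin k → Bool) → Set (ℕ → Bool) := fun v => {y | ∀ i ∈ Finset.range k, y i = ext v i}
  have hC : ∀ v y, y ∈ C v ↔ (fun i : Fin k => y i) = v := by
    intro v y
    simp only [C, ext, Set.mem_ofPred_eq, Finset.mem_range, funext_iff]
    exact ⟨fun h i => by simpa using h i i.2, fun h i hi => by simpa [hi] using h ⟨i, hi⟩⟩
  have hU : ClopSet F = ⋃ v ∈ S, C v := by
    ext y
    rw [mem_ClopSet_iff_prefix_ofFn hk.ge]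
    simp [hS, hC]
  rw [hU, measureReal_biUnion_finset]
  · simp only [C, coinMeasure_pi_singleton]
    rw [hdef]
    simp [div_eq_mul_inv]
  · intro v _ w _ hvw
    refine Set.disjoint_left.2 fun y hv hw => hvw ?_
    rw [← (hC v y).1 hv, (hC w y).1 hw]
  · intro v _
    have : C v = Set.pi (Finset.range k) fun i => {ext v i} := by
      ext y; simp [C, Set.mem_pi]
    rw [this]
    exact MeasurableSet.pi (Finset.countable_toSet _) fun i _ => measurableSet_singleton _

theorem listMeasure_le_iff {F : List (List Bool)} {n : ℕ} :
    listMeasure F ≤ (1 / 2) ^ n ↔ coinMeasure.real (ClopSet F) ≤ (1 / 2) ^ n := by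
  rw [← listMeasure_eq]
  rw [← Rat.cast_le (K := ℝ)]
  simp

end Measure

/-! ### Primitive recursive operations on finite sets of strings -/

section Strings

/-- The list of all binary strings of length `k`. -/
def allStrings : ℕ → List (List Bool) :=
  Nat.rec [[]] fun _ S => S.map (List.cons true) ++ S.map (List.cons false)

theorem allStrings_succ (k : ℕ) : allStrings (k + 1) =
    (allStrings k).map (List.cons true) ++ (allStrings k).map (List.cons false) := rfl

theorem mem_allStrings {k : ℕ} {v : List Bool} : v ∈ allStrings k ↔ v.length = k := by
  induction k generalizing v with
  | zero => simp [allStrings]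
  | succ k ih =>
    rw [allStrings_succ]
    cases v with
    | nil => simp
    | cons b v => cases b <;> simp [ih]

theorem nodup_allStrings (k : ℕ) : (allStrings k).Nodup := by
  induction k with
  | zero => simp [allStrings]
  | succ k ih =>
    rw [allStrings_succ, List.nodup_append]
    refine ⟨ih.map List.cons_injective, ih.map List.cons_injective, ?_⟩
    simp

theorem length_allStrings (k : ℕ) : (allStrings k).length = 2 ^ k := by
  induction k with
  | zero => simp [allStrings]
  | succ k ih => rw [allStrings_succ]; simp [ih]; omega

theorem primrec_allStrings : Primrec allStrings :=
  Primrec.nat_rec₁ _ <| Primrec.list_append.comp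
    (Primrec.list_map .snd (Primrec.list_cons.comp (.const true) .snd))
    (Primrec.list_map .snd (Primrec.list_cons.comp (.const false) .snd))

theorem primrec_maxLength : Primrec maxLength :=
  Primrec.list_foldr (Primrec.list_map .id (Primrec.list_length.comp .snd).to₂) (.const 0)
    (Primrec.nat_max.comp (Primrec.fst.comp .snd) (Primrec.snd.comp .snd)).to₂

theorem listMeasure_eq_length_filter (F : List (List Bool)) :
    listMeasure F = (((allStrings (maxLength F)).filter
      fun v => ∃ σ ∈ F, v.take σ.length = σ).length : ℚ) / 2 ^ maxLength F := by
  classical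
  set k := maxLength F with hk
  have hdef : listMeasure F = ((Finset.univ.filter fun v : Fin k → Bool =>
      ∃ σ ∈ F, σ <+: List.ofFn v).card : ℚ) / 2 ^ k := by
    unfold listMeasure
    simp only [hk, maxLength]
    congr!
  rw [hdef, ← List.toFinset_card_of_nodup ((nodup_allStrings k).filter _),
    ← Finset.card_image_of_injective _ List.ofFn_injective]
  congr 3
  ext v
  simp only [Finset.mem_image, Finset.mem_filter, Finset.mem_univ, true_and, List.mem_toFinset,
    List.mem_filter, mem_allStrings, decide_eq_true_eq, List.prefix_iff_eq_take,
    fun σ w : List Bool => eq_comm (a := w.take σ.length) (b := σ)]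
  constructor
  · rintro ⟨w, hw, rfl⟩
    exact ⟨by simp, hw⟩
  · rintro ⟨hv, h⟩
    have : List.ofFn (fun i : Fin k => v[i]'(by omega)) = v := 
      List.ext_getElem (by simp [hv]) (by simp)
    exact ⟨_, by rwa [this], this⟩

theorem primrecPred_listMeasure_le :
    PrimrecPred fun p : List (List Bool) × ℕ => listMeasure p.1 ≤ (1 / 2) ^ p.2 := by
  have hpre : PrimrecRel fun (σ v : List Bool) => v.take σ.length = σ :=
    Primrec.eq.comp (Primrec.list_take.comp (Primrec.list_length.comp .fst) .snd) .fst
  have hex : PrimrecRel fun (v : List Bool) (F : List (List Bool)) =>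
      ∃ σ ∈ F, v.take σ.length = σ :=
    hpre.exists_mem_list.comp .snd .fst
  have hcount : Primrec fun F : List (List Bool) => ((allStrings (maxLength F)).filter
      fun v => ∃ σ ∈ F, v.take σ.length = σ).length :=
    Primrec.list_length.comp
      (hex.listFilter.comp (primrec_allStrings.comp primrec_maxLength) .id)
  have hle : PrimrecPred fun p : List (List Bool) × ℕ =>
      ((allStrings (maxLength p.1)).filter fun v => ∃ σ ∈ p.1, v.take σ.length = σ).length *
        (allStrings p.2).length ≤ (allStrings (maxLength p.1)).length :=
    Primrec.nat_le.comp
      (Primrec.nat_mul.comp (hcount.comp .fst)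
        (Primrec.list_length.comp (primrec_allStrings.comp .snd)))
      (Primrec.list_length.comp (primrec_allStrings.comp (primrec_maxLength.comp .fst)))
  refine hle.of_eq fun p => ?_
  rw [listMeasure_eq_length_filter, length_allStrings, length_allStrings,
    div_le_iff₀ (by positivity), one_div, inv_pow, inv_mul_eq_div, le_div_iff₀ (by positivity)]
  exact_mod_cast Iff.rfl

/-- The strings of length `k` that vanish at every position in `T`. -/
def zeroStrings (k : ℕ) (T : List ℕ) : List (List Bool) :=
  (allStrings k).filter fun v => ∀ t ∈ T, v[t]? = some false

theorem primrec_zeroStrings : Primrec₂ zeroStrings := by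
  have h : PrimrecRel fun (t : ℕ) (v : List Bool) => v[t]? = some false :=
    Primrec.eq.comp (Primrec.list_getElem?.comp .snd .fst) (.const _)
  have h' : PrimrecRel fun (v : List Bool) (T : List ℕ) => ∀ t ∈ T, v[t]? = some false :=
    h.forall_mem_list.comp .snd .fst
  exact h'.listFilter.comp (primrec_allStrings.comp .fst) .snd

theorem ClopSet_zeroStrings {k : ℕ} {T : List ℕ} (hT : ∀ t ∈ T, t < k) :
    ClopSet (zeroStrings k T) = {x | ∀ t ∈ T, x t = false} := by
  ext x
  simp only [ClopSet, zeroStrings, Set.mem_iUnion, exists_prop, List.mem_filter, mem_allStrings,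
    decide_eq_true_eq, Set.mem_ofPred_eq, Cyl]
  constructor
  · rintro ⟨σ, ⟨hσ, h0⟩, hx⟩ t ht
    rw [hx t (hσ ▸ hT t ht), List.getD_eq_getElem?_getD, h0 t ht, Option.getD_some]
  · intro h
    refine ⟨List.ofFn fun i : Fin k => x i, ⟨by simp, fun t ht => ?_⟩, fun i hi => ?_⟩
    · simp [hT t ht, h t ht]
    · rw [List.length_ofFn] at hi
      simp [hi]

end Strings

/-! ### A highness bound captures all Kurtz tests -/

section Cover

open Nat.Partrec

/-- The output of the `e`-th program on input `n` after `t` steps, read as a clopen set and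
discarded unless its measure is at most `2 ^ (-n)`. -/
noncomputable def testStage (t e n : ℕ) : List (List Bool) :=
  let F := ((Code.evaln t (Denumerable.ofNat Code e) n).bind
    (Encodable.decode (α := List (List Bool)))).getD []
  if listMeasure F ≤ (1 / 2) ^ n then F else []

theorem primrec_testStage : Primrec fun p : ℕ × ℕ × ℕ => testStage p.1 p.2.1 p.2.2 := by
  have heval : Primrec fun p : ℕ × ℕ × ℕ =>
      Code.evaln p.1 (Denumerable.ofNat Code p.2.1) p.2.2 :=
    Code.primrec_evaln.comp
      ((Primrec.fst.pair ((Primrec.ofNat Code).comp (Primrec.fst.comp Primrec.snd))).pair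
        (Primrec.snd.comp Primrec.snd))
  have hF : Primrec fun p : ℕ × ℕ × ℕ =>
      ((Code.evaln p.1 (Denumerable.ofNat Code p.2.1) p.2.2).bind
        (Encodable.decode (α := List (List Bool)))).getD [] :=
    Primrec.option_getD.comp (Primrec.option_bind heval (Primrec.decode.comp Primrec.snd).to₂)
      (Primrec.const [])
  have hc := primrecPred_listMeasure_le.comp (hF.pair (Primrec.snd.comp Primrec.snd))
  exact (Primrec.ite hc hF (Primrec.const [])).of_eq fun _ => rfl

theorem coinMeasure_testStage_le (t e n : ℕ) :
    coinMeasure.real (ClopSet (testStage t e n)) ≤ (1 / 2) ^ n := by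
  unfold testStage
  dsimp only
  split_ifs with h
  · exact listMeasure_le_iff.1 h
  · simp [ClopSet]

/-- The union of the `2m`-th and `(2m+1)`-st clopen sets of the first `m` programs,
as far as they are computed after `t` steps. -/
noncomputable def coverStage (m t : ℕ) : List (List Bool) :=
  (List.range m).flatMap fun e => testStage t e (2 * m) ++ testStage t e (2 * m + 1)

theorem primrec_coverStage : Primrec₂ coverStage := by
  have hm : Primrec fun q : (ℕ × ℕ) × ℕ => 2 * q.1.1 :=
    Primrec.nat_mul.comp (Primrec.const 2) (Primrec.fst.comp Primrec.fst)
  have ht : Primrec fun q : (ℕ × ℕ) × ℕ => q.1.2 := Primrec.snd.comp Primrec.fst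
  have h₀ : Primrec fun q : (ℕ × ℕ) × ℕ => testStage q.1.2 q.2 (2 * q.1.1) :=
    (primrec_testStage.comp (ht.pair (Primrec.snd.pair hm))).of_eq fun _ => rfl
  have h₁ : Primrec fun q : (ℕ × ℕ) × ℕ => testStage q.1.2 q.2 (2 * q.1.1 + 1) :=
    (primrec_testStage.comp (ht.pair (Primrec.snd.pair (Primrec.succ.comp hm)))).of_eq fun _ => rfl
  have h := Primrec.list_flatMap (Primrec.list_range.comp Primrec.fst)
    (Primrec.list_append.comp h₀ h₁).to₂
  exact h.of_eq fun _ => rfl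

theorem listMeasure_coverStage_le (m t : ℕ) : listMeasure (coverStage m t) ≤ (1 / 2) ^ m := by
  rw [listMeasure_le_iff, coverStage, ClopSet_flatMap]
  have hpiece : ∀ e, coinMeasure.real
      (ClopSet (testStage t e (2 * m) ++ testStage t e (2 * m + 1))) ≤
        3 / 2 * ((1 / 2) ^ m * (1 / 2) ^ m) := by
    intro e
    rw [ClopSet_append]
    refine (MeasureTheory.measureReal_union_le _ _).trans ?_
    have h₀ := coinMeasure_testStage_le t e (2 * m)
    have h₁ := coinMeasure_testStage_le t e (2 * m + 1)
    rw [pow_succ] at h₁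
    rw [two_mul m, pow_add] at h₀ h₁
    rw [two_mul m]
    linarith
  have hsum : coinMeasure.real (⋃ e ∈ Finset.range m,
      ClopSet (testStage t e (2 * m) ++ testStage t e (2 * m + 1))) ≤
        m * (3 / 2 * ((1 / 2) ^ m * (1 / 2) ^ m)) := by
    refine (MeasureTheory.measureReal_biUnion_finset_le _ _).trans ?_
    refine (Finset.sum_le_sum fun e _ => hpiece e).trans ?_
    simp
  simp only [Finset.mem_range, List.mem_range] at hsum ⊢
  refine hsum.trans ?_
  have hm : (3 / 2 * m : ℝ) ≤ 2 ^ m := by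
    rcases m with _ | m
    · simp
    · have : m + 1 ≤ 2 ^ m := m.lt_two_pow_self
      have : (m + 1 : ℝ) ≤ 2 ^ m := by exact_mod_cast this
      push_cast
      rw [pow_succ]
      linarith
  have hp : (0 : ℝ) < (1 / 2) ^ m := by positivity
  have h1 : (2 : ℝ) ^ m * (1 / 2) ^ m = 1 := by rw [← mul_pow]; norm_num
  nlinarith [mul_le_mul_of_nonneg_right hm (mul_pos hp hp).le]

/-- A computable test is computed, within a computable number of steps, by some program. -/
theorem KurtzTest.exists_time {L : ℕ → List (List Bool)} (hL : KurtzTest L) :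
    ∃ (e : ℕ) (g : ℕ → ℕ), Computable g ∧ ∀ m t, g m ≤ t →
      testStage t e (2 * m) = L (2 * m) ∧ testStage t e (2 * m + 1) = L (2 * m + 1) := by
  obtain ⟨c, hc⟩ := Code.exists_code.1 hL.1
  have hc' : ∀ n, Encodable.encode (L n) ∈ c.eval n := fun n => by rw [hc]; simp
  have hstep : ∀ {n t x}, x ∈ c.evaln t n → x = Encodable.encode (L n) := fun h =>
    Part.mem_unique (Code.evaln_sound h) (hc' _)
  let P : ℕ → ℕ → Bool := fun m t =>
    (c.evaln t (2 * m)).isSome && (c.evaln t (2 * m + 1)).isSome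
  have hP : Computable₂ P := by
    have hm : Primrec fun p : ℕ × ℕ => 2 * p.1 :=
      Primrec.nat_mul.comp (Primrec.const 2) Primrec.fst
    have h₀ : Primrec fun p : ℕ × ℕ => c.evaln p.2 (2 * p.1) :=
      Code.primrec_evaln.comp ((Primrec.snd.pair (Primrec.const c)).pair hm)
    have h₁ : Primrec fun p : ℕ × ℕ => c.evaln p.2 (2 * p.1 + 1) :=
      Code.primrec_evaln.comp ((Primrec.snd.pair (Primrec.const c)).pair (Primrec.succ.comp hm))
    exact (Primrec.and.comp (Primrec.option_isSome.comp h₀)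
      (Primrec.option_isSome.comp h₁)).to_comp
  have hex : ∀ m, ∃ t, P m t = true := by
    intro m
    obtain ⟨s, hs⟩ := Code.evaln_complete.1 (hc' (2 * m))
    obtain ⟨t, ht⟩ := Code.evaln_complete.1 (hc' (2 * m + 1))
    refine ⟨max s t, ?_⟩
    have hs' := Code.evaln_mono (le_max_left s t) hs
    have ht' := Code.evaln_mono (le_max_right s t) ht
    simp [P, Option.mem_def.1 hs', Option.mem_def.1 ht']
  have hstage : ∀ {n s t}, (c.evaln s n).isSome → s ≤ t →
      testStage t (Encodable.encode c) n = L n := by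
    intro n s t h hst
    obtain ⟨x, hx⟩ := Option.isSome_iff_exists.1 h
    obtain rfl := hstep hx
    have := Option.mem_def.1 (Code.evaln_mono hst hx)
    simp only [testStage, Denumerable.ofNat_encode, this, Option.bind_some, Encodable.encodek,
      Option.getD_some]
    exact if_pos (hL.2 n)
  refine ⟨Encodable.encode c, fun m => Nat.find (hex m), ?_, fun m t ht => ?_⟩
  · refine (Partrec.rfind hP.partrec₂).of_eq fun m => ?_
    refine Part.eq_some_iff.2 (Nat.mem_rfind.2 ⟨?_, fun {k} hk => ?_⟩)
    · simpa using (Nat.find_spec (hex m)).symm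
    · simpa using (Bool.eq_false_iff.2 (Nat.find_min (hex m) hk)).symm
  · have h := Bool.and_eq_true_iff.1 (Nat.find_spec (hex m))
    exact ⟨hstage h.1 ht, hstage h.2 ht⟩

theorem High.exists_kurtzTestIn {A : Set ℕ} (hA : High A) :
    ∃ G : ℕ → List (List Bool), KurtzTestIn A G ∧
      ∀ L, KurtzTest L → ∀ᶠ m in atTop,
        ClopSet (L (2 * m)) ∪ ClopSet (L (2 * m + 1)) ⊆ ClopSet (G m) := by
  obtain ⟨f, hf, hdom⟩ := hA
  refine ⟨fun m => coverStage m (f m), ⟨?_, fun m => listMeasure_coverStage_le m _⟩, ?_⟩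
  · have hpair : ComputableIn A fun m => (m, f m) :=
      ComputableIn.pair (f := fun m => m) (.of_computable Computable.id) hf
    have hcover : ComputableIn A fun p : ℕ × ℕ => coverStage p.1 p.2 :=
      .of_computable primrec_coverStage.to_comp
    exact (hcover.comp hpair).of_eq fun _ => rfl
  · intro L hL
    obtain ⟨e, g, hg, htime⟩ := hL.exists_time
    filter_upwards [hdom g hg, eventually_gt_atTop e] with m hm he
    obtain ⟨h₀, h₁⟩ := htime m (f m) hm
    rw [← ClopSet_append, ← h₀, ← h₁, coverStage, ClopSet_flatMap]
    exact Set.subset_biUnion_of_mem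
      (u := fun e => ClopSet (testStage (f m) e (2 * m) ++ testStage (f m) e (2 * m + 1)))
      (List.mem_range.2 he)

end Cover

/-! ### Kurtz engulfing oracles are high -/

section Engulfing

/-- The Kurtz test whose null set consists of the sequences vanishing on the range of `g`. -/
def rangeTest (g : ℕ → ℕ) (m : ℕ) : List (List Bool) :=
  zeroStrings (g m) ((List.range m).map g)

theorem computable_map_range {g : ℕ → ℕ} (hg : Computable g) :
    Computable fun m => (List.range m).map g := by
  have hstep : Computable fun q : ℕ × ℕ × List ℕ => q.2.2 ++ [g q.2.1] :=
    Computable.list_concat.comp (Computable.snd.comp Computable.snd)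
      (hg.comp (Computable.fst.comp Computable.snd))
  refine (Computable.nat_rec Computable.id (Computable.const []) hstep.to₂).of_eq fun m => ?_
  simp only [id]
  induction m with
  | zero => rfl
  | succ k ih => simp [List.range_succ, ih]

theorem ClopSet_rangeTest {g : ℕ → ℕ} (hg : StrictMono g) (m : ℕ) :
    ClopSet (rangeTest g m) = {x | ∀ j < m, x (g j) = false} := by
  rw [rangeTest, ClopSet_zeroStrings]
  · simp
  · simp only [List.mem_map, List.mem_range]
    rintro _ ⟨j, hj, rfl⟩
    exact hg hj

theorem kurtzTest_rangeTest {g : ℕ → ℕ} (hg : StrictMono g) (hc : Computable g) :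
    KurtzTest (rangeTest g) := by
  refine ⟨primrec_zeroStrings.to_comp.comp hc (computable_map_range hc), fun m => ?_⟩
  rw [listMeasure_le_iff, ClopSet_rangeTest hg]
  have h := coinMeasure_pi_singleton ((Finset.range m).image g) fun _ => false
  rw [Finset.card_image_of_injective _ hg.injective, Finset.card_range] at h
  simpa using h.le

/-- If a clopen set of measure at most `2 ^ (-(n + 1))` contains all sequences vanishing on the
range of `g`, then it depends on more than `g n` bits. -/
theorem lt_maxLength_of_subset {g : ℕ → ℕ} (hg : StrictMono g) {F : List (List Bool)} {n : ℕ}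
    (hF : listMeasure F ≤ (1 / 2) ^ (n + 1)) (h : {x | ∀ j, x (g j) = false} ⊆ ClopSet F) :
    g n < maxLength F := by
  by_contra! hn
  have hsub : {x : ℕ → Bool | ∀ i ∈ (Finset.range n).image g, x i = false} ⊆ ClopSet F := by
    intro x hx
    let y : ℕ → Bool := fun i => if i < maxLength F then x i else false
    have hy : y ∈ ClopSet F := h fun j => by
      rcases lt_or_ge j n with hj | hj
      · simp [y, hx (g j) (Finset.mem_image_of_mem g (Finset.mem_range.2 hj))]
      · simp [y, (hn.trans (hg.monotone hj)).not_gt]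
    exact (mem_ClopSet_congr fun i hi => by simp [y, hi]).2 hy
  have h₁ := MeasureTheory.measureReal_mono (μ := coinMeasure) hsub
  rw [coinMeasure_pi_singleton ((Finset.range n).image g) fun _ => false,
    Finset.card_image_of_injective _ hg.injective, Finset.card_range] at h₁
  have h₂ := h₁.trans (listMeasure_le_iff.1 hF)
  rw [pow_succ] at h₂
  have : (0 : ℝ) < (1 / 2) ^ n := by positivity
  linarith

theorem exists_strictMono_computable_ge {g : ℕ → ℕ} (hg : Computable g) :
    ∃ g' : ℕ → ℕ, Computable g' ∧ StrictMono g' ∧ ∀ n, g n ≤ g' n := by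
  let S : ℕ → ℕ := fun m => Nat.rec (motive := fun _ => ℕ) 0 (fun y i => i + (g y + 1)) m
  have hS : Computable S := by
    have hstep : Computable fun q : ℕ × ℕ × ℕ => q.2.2 + (g q.2.1 + 1) :=
      Primrec.nat_add.to_comp.comp (Computable.snd.comp Computable.snd)
        (Computable.succ.comp (hg.comp (Computable.fst.comp Computable.snd)))
    exact Computable.nat_rec Computable.id (Computable.const 0) hstep.to₂
  have hsucc : ∀ m, S (m + 1) = S m + (g m + 1) := fun _ => rfl
  refine ⟨fun n => S (n + 1), hS.comp Computable.succ, strictMono_nat_of_lt_succ fun n => ?_,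
    fun n => ?_⟩
  · have := hsucc (n + 1)
    omega
  · have := hsucc n
    dsimp only
    omega

theorem KurtzEngulfing.high {A : Set ℕ} (hA : KurtzEngulfing A) : High A := by
  obtain ⟨G, hG, hmeas, hcov⟩ := hA
  have hF : ComputableIn A fun p : ℕ × ℕ => maxLength (G p.1 (p.2 + 1)) := by
    have hshift : ComputableIn A fun p : ℕ × ℕ => (p.1, p.2 + 1) :=
      .of_computable (Computable.fst.pair (Computable.succ.comp Computable.snd))
    have hlen : ComputableIn A maxLength := .of_computable primrec_maxLength.to_comp
    exact (hlen.comp (hG.comp hshift)).of_eq fun _ => rfl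
  refine ⟨_, hF.sup_range, fun g hg => ?_⟩
  obtain ⟨g', hc, hmono, hle⟩ := exists_strictMono_computable_ge hg
  obtain ⟨i, hi⟩ := hcov _ (kurtzTest_rangeTest hmono hc)
  filter_upwards [eventually_ge_atTop i] with n hn
  have hsub : {x | ∀ j, x (g' j) = false} ⊆ ClopSet (G i (n + 1)) := by
    intro x hx
    refine Set.mem_iInter.1 (hi (Set.mem_iInter.2 fun m => ?_)) (n + 1)
    rw [ClopSet_rangeTest hmono]
    exact fun j _ => hx j
  exact ((hle n).trans (lt_maxLength_of_subset hmono (hmeas i (n + 1)) hsub).le).trans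
    (Finset.le_sup (f := fun i => maxLength (G i (n + 1))) (Finset.mem_range.2 (by omega)))

end Engulfing

/-- `A` is high iff (ii) some Kurtz test relative to `A` satisfies
`L_{2m} ∪ L_{2m+1} ⊆ G_m` for almost all `m`, for every Kurtz test `(L_m)`, iff (iii)
some Kurtz test relative to `A` eventually engulfs every Kurtz test, iff (iv) `A` is
Kurtz engulfing. -/
theorem stmt4 (A : Set ℕ) :
    [High A,
     ∃ G : ℕ → List (List Bool), KurtzTestIn A G ∧
       ∀ L, KurtzTest L → ∀ᶠ m in atTop,
         ClopSet (L (2 * m)) ∪ ClopSet (L (2 * m + 1)) ⊆ ClopSet (G m),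
     ∃ G : ℕ → List (List Bool), KurtzTestIn A G ∧
       ∀ L, KurtzTest L → ∃ m₀,
         (⋂ m, ⋂ (_ : m₀ ≤ m), ClopSet (L m)) ⊆ ⋂ m, ⋂ (_ : m₀ ≤ m), ClopSet (G m),
     KurtzEngulfing A].TFAE := by
  tfae_have 1 → 2 := High.exists_kurtzTestIn
  tfae_have 2 → 3 := by
    rintro ⟨G, hG, h⟩
    refine ⟨G, hG, fun L hL => ?_⟩
    obtain ⟨m₀, hm₀⟩ := eventually_atTop.1 (h L hL)
    refine ⟨m₀, fun x hx => ?_⟩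
    simp only [Set.mem_iInter] at hx ⊢
    exact fun m hm => hm₀ m hm (Or.inl (hx (2 * m) (by omega)))
  tfae_have 3 → 4 := by
    rintro ⟨G, ⟨hG, hmeas⟩, h⟩
    have hadd : ComputableIn A fun p : ℕ × ℕ => p.1 + p.2 :=
      .of_computable Primrec.nat_add.to_comp
    refine ⟨fun i m => G (i + m), (hG.comp hadd).of_eq fun _ => rfl, fun i m => ?_,
      fun L hL => ?_⟩
    · exact (hmeas (i + m)).trans
        (pow_le_pow_of_le_one (by norm_num) (by norm_num) (Nat.le_add_left m i))
    · obtain ⟨m₀, hm₀⟩ := h L hL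
      refine ⟨m₀, fun x hx => Set.mem_iInter.2 fun m => ?_⟩
      have hx' := hm₀ (Set.mem_iInter₂.2 fun k _ => Set.mem_iInter.1 hx k)
      exact Set.mem_iInter₂.1 hx' (m₀ + m) (Nat.le_add_right m₀ m)
  tfae_have 4 → 1 := KurtzEngulfing.high
  tfae_finish

end CichonAnalog
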